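/- Let G be an ordered mean that commutes with positive unital linear maps in the sense Φ(Gₙ(ω; A₁,…,Aₙ)) ≤ Gₙ(ω; Φ(A₁),…,Φ(Aₙ)) for all positive unital linear maps Φ. Then for μ ≥ 0, the parameterized mean satisfies Φ(G^μₙ(ω; A₁,…,Aₙ)) ≤ G^μₙ(ω; Φ(A₁),…,Φ(Aₙ)), and for μ < 0 it satisfies Φ(G^μₙ(ω; A₁,…,Aₙ)) ≥ G^μₙ(ω; Φ(A₁⁻¹)⁻¹, …, Φ(Aₙ⁻¹)⁻¹). -/

import Mathlib

open ContinuousLinearMap in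
/-- A positive definite (positive invertible) bounded operator on a Hilbert space. -/
def IsPosDef {H : Type*} [NormedAddCommGroup H] [InnerProductSpace ℂ H] [CompleteSpace H]
    (A : H →L[ℂ] H) : Prop := A.IsPositive ∧ IsUnit A

/-- A positive probability vector. -/
def IsProbVec {n : ℕ} (w : Fin n → ℝ) : Prop := (∀ i, 0 < w i) ∧ ∑ i, w i = 1

/-- An ordered mean: a family of weighted means of positive definite operators satisfying
homogeneity, monotonicity, joint concavity and the arithmetic-`G`-harmonic mean inequalities
with respect to the Loewner order. -/
structure OrderedMean (H : Type*) [NormedAddCommGroup H] [InnerProductSpace ℂ H]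
    [CompleteSpace H] where
  G : ∀ n : ℕ, (Fin n → ℝ) → (Fin n → (H →L[ℂ] H)) → (H →L[ℂ] H)
  posDef : ∀ n w A, IsProbVec w → (∀ i, IsPosDef (A i)) → IsPosDef (G n w A)
  homog : ∀ n w A (a : ℝ), IsProbVec w → (∀ i, IsPosDef (A i)) → 0 < a →
    G n w (fun i => a • A i) = a • G n w A
  mono : ∀ n w A B, IsProbVec w → (∀ i, IsPosDef (A i)) → (∀ i, IsPosDef (B i)) →
    (∀ i, B i ≤ A i) → G n w B ≤ G n w A
  concave : ∀ n w A B (s : ℝ), IsProbVec w → (∀ i, IsPosDef (A i)) → (∀ i, IsPosDef (B i)) →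
    0 ≤ s → s ≤ 1 →
    (1 - s) • G n w A + s • G n w B ≤ G n w (fun i => (1 - s) • A i + s • B i)
  harm_le : ∀ n w A, IsProbVec w → (∀ i, IsPosDef (A i)) →
    Ring.inverse (∑ i, w i • Ring.inverse (A i)) ≤ G n w A
  le_arith : ∀ n w A, IsProbVec w → (∀ i, IsPosDef (A i)) →
    G n w A ≤ ∑ i, w i • A i

/-- The parameterized ordered mean `G^μ`. -/
noncomputable def OrderedMean.pMean {H : Type*} [NormedAddCommGroup H] [InnerProductSpace ℂ H]
    [CompleteSpace H] (G : OrderedMean H) (μ : ℝ) (n : ℕ) (w : Fin n → ℝ)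
    (A : Fin n → (H →L[ℂ] H)) : H →L[ℂ] H :=
  if 0 ≤ μ then G.G n w (fun i => A i + μ • 1) - μ • 1
  else Ring.inverse (G.G n w (fun i => Ring.inverse (A i) + (-μ) • 1) - (-μ) • 1)

/-- The constant `ρ_{M,m}(t)`. -/
noncomputable def rhoConst (M m t : ℝ) : ℝ :=
  if M / m ≤ t then (1 - t) * m
  else if t ≤ m / M then (1 - t) * M
  else M + m - 2 * Real.sqrt (t * M * m)

variable {H : Type*} [NormedAddCommGroup H] [InnerProductSpace ℂ H] [CompleteSpace H]

section Resolution

open scoped unitInterval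

/-- Bernstein partitions of unity turn a strictly positive element into an approximate
combination of positive elements summing to `1`, compatibly with inversion. -/
lemma IsStrictlyPositive.exists_approx_resolution {B : Type*} [CStarAlgebra B] [PartialOrder B]
    [StarOrderedRing B] {a : B} (ha : IsStrictlyPositive a) {ε : ℝ} (hε : 0 < ε) :
    ∃ (m : ℕ) (P : Fin m → B) (t : Fin m → ℝ), (∀ k, 0 ≤ P k) ∧ ∑ k, P k = 1 ∧ (∀ k, 0 < t k) ∧
      ∑ k, t k • P k ≤ a + ε • 1 ∧ ∑ k, (t k)⁻¹ • P k ≤ Ring.inverse a + ε • 1 := by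
  obtain _ | _ := subsingleton_or_nontrivial B
  · exact ⟨0, Fin.elim0, Fin.elim0, by simp, Subsingleton.elim _ _, by simp,
      (Subsingleton.elim _ _).le, (Subsingleton.elim _ _).le⟩
  have hsa : IsSelfAdjoint a := .of_nonneg ha.nonneg
  obtain ⟨c, hc, hca⟩ := (CFC.exists_pos_algebraMap_le_iff hsa).2 fun x hx ↦ ha.spectrum_pos hx
  have hlow : ∀ x ∈ spectrum ℝ a, c ≤ x := (algebraMap_le_iff_le_spectrum hsa).1 hca
  have hup : ∀ x ∈ spectrum ℝ a, x ≤ ‖a‖ :=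
    (le_algebraMap_iff_spectrum_le hsa).1 hsa.le_algebraMap_norm_self
  set M := ‖a‖
  have hM : 0 < M := norm_pos_iff.2 ha.isUnit.ne_zero
  let f : C(I, ℝ) := ⟨fun s ↦ max (M * s) c, by fun_prop⟩
  have hf : ∀ s, 0 < f s := fun s ↦ lt_max_of_lt_right hc
  let g : C(I, ℝ) := ⟨fun s ↦ (f s)⁻¹, f.continuous.inv₀ fun s ↦ (hf s).ne'⟩
  obtain ⟨n, hnf, hng⟩ := ((Metric.tendsto_nhds.1 (bernsteinApproximation_uniform f) ε hε).and
    (Metric.tendsto_nhds.1 (bernsteinApproximation_uniform g) ε hε)).exists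
  let b : Fin (n + 1) → ℝ → ℝ := fun k x ↦ n.choose k * (x / M) ^ (k : ℕ) * (1 - x / M) ^ (n - k)
  have hbc : ∀ k, Continuous (b k) := fun k ↦ by fun_prop
  let s : spectrum ℝ a → I := fun x ↦ ⟨x / M, div_nonneg (hc.le.trans (hlow x x.2)) hM.le,
    (div_le_one hM).2 (hup x x.2)⟩
  have hb : ∀ k, ∀ x : spectrum ℝ a, b k x = bernstein n k (s x) := fun k x ↦ by
    simp [b, s, bernstein_apply]
  have key : ∀ (h : C(I, ℝ)), dist (bernsteinApproximation n h) h < ε →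
      ∀ F : ℝ → ℝ, ContinuousOn F (spectrum ℝ a) → (∀ x : spectrum ℝ a, h (s x) = F x) →
      ∑ k : Fin (n + 1), h (bernstein.z k) • cfc (b k) a ≤ cfc F a + ε • 1 := by
    intro h hh F hF hFh
    have e : ∑ k : Fin (n + 1), h (bernstein.z k) • cfc (b k) a =
        cfc (fun x ↦ ∑ k : Fin (n + 1), h (bernstein.z k) * b k x) a := by
      rw [show (fun x ↦ ∑ k : Fin (n + 1), h (bernstein.z k) * b k x) =
        ∑ k : Fin (n + 1), fun x ↦ h (bernstein.z k) * b k x by ext; simp,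
        cfc_sum_univ (fun k x ↦ h (bernstein.z k) * b k x) a (fun k ↦ by fun_prop)]
      exact Finset.sum_congr rfl fun k _ ↦ (cfc_const_mul _ (b k) a).symm
    rw [e, ← Algebra.algebraMap_eq_smul_one, ← cfc_add_const ε F a]
    refine cfc_mono (fun x hx ↦ ?_) (by fun_prop) (by fun_prop)
    have h1 := (ContinuousMap.dist_apply_le_dist (f := bernsteinApproximation n h) (g := h)
      (s ⟨x, hx⟩)).trans hh.le
    rw [Real.dist_eq, bernsteinApproximation.apply, hFh ⟨x, hx⟩] at h1
    have h2 := (abs_le.1 h1).2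
    simp only [← hb, smul_eq_mul] at h2
    simp only [mul_comm (h _)]
    linarith
  refine ⟨n + 1, fun k ↦ cfc (b k) a, fun k ↦ f (bernstein.z k), fun k ↦ ?_, ?_,
    fun k ↦ hf _, ?_, ?_⟩
  · exact cfc_nonneg fun x hx ↦ (hb k ⟨x, hx⟩).symm ▸ bernstein_nonneg
  · rw [← cfc_sum_univ _ a (fun k ↦ by fun_prop), ← cfc_one ℝ a]
    refine cfc_congr fun x hx ↦ ?_
    simp only [Finset.sum_apply, hb _ ⟨x, hx⟩, bernstein.probability, Pi.one_apply]
  · have := key f hnf id continuousOn_id fun x ↦ by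
      simp [f, s, mul_div_cancel₀ _ hM.ne', hlow x x.2]
    rwa [cfc_id ℝ a] at this
  · have := key g hng (fun x ↦ x⁻¹)
      (continuousOn_id.inv₀ fun x hx ↦ (hc.trans_le (hlow x hx)).ne') fun x ↦ by
      simp [f, g, s, mul_div_cancel₀ _ hM.ne', hlow x x.2]
    rwa [cfc_ringInverse_id a ha.isUnit] at this

end Resolution

section Hilbert

variable {E : Type*} [NormedAddCommGroup E] [InnerProductSpace ℂ E]

lemma re_inner_quadratic_nonneg {Q : E →L[ℂ] E} (hQ : 0 ≤ Q) {t : ℝ} (ht : 0 < t) (x y : E) :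
    0 ≤ t * (inner ℂ (Q x) x).re + 2 * (inner ℂ (Q x) y).re + t⁻¹ * (inner ℂ (Q y) y).re := by
  rw [ContinuousLinearMap.nonneg_iff_isPositive] at hQ
  have h := hQ.re_inner_nonneg_left ((t : ℂ) • x + y)
  have hs : (inner ℂ (Q y) x).re = (inner ℂ (Q x) y).re := by
    rw [hQ.isSymmetric.apply_clm y x, ← inner_conj_symm, Complex.conj_re]
  simp only [map_add, map_smul, inner_add_left, inner_add_right, inner_smul_left,
    inner_smul_right, Complex.conj_ofReal, RCLike.re_to_complex, Complex.add_re,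
    Complex.re_ofReal_mul, hs] at h
  have h2 := mul_nonneg (inv_nonneg.2 ht.le) h
  field_simp at h2 ⊢
  linarith

variable {Φ : (E →L[ℂ] E) →ₗ[ℂ] (E →L[ℂ] E)}

lemma map_real_smul_one (hΦ1 : Φ 1 = 1) (c : ℝ) : Φ (c • 1) = c • 1 := by
  rw [LinearMap.map_smul_of_tower, hΦ1]

variable [CompleteSpace E]

lemma isPosDef_iff_isStrictlyPositive {T : E →L[ℂ] E} : IsPosDef T ↔ IsStrictlyPositive T := by
  rw [IsPosDef, IsStrictlyPositive, ContinuousLinearMap.nonneg_iff_isPositive]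

lemma isStrictlyPositive_of_smul_one_le {T : E →L[ℂ] E} {c : ℝ} (hc : 0 < c) (h : c • 1 ≤ T) :
    IsStrictlyPositive T :=
  .of_le (isStrictlyPositive_one.smul hc) h

lemma IsStrictlyPositive.exists_pos_smul_one_le {T : E →L[ℂ] E} (hT : IsStrictlyPositive T) :
    ∃ c : ℝ, 0 < c ∧ c • 1 ≤ T := by
  obtain _ | _ := subsingleton_or_nontrivial (E →L[ℂ] E)
  · exact ⟨1, one_pos, (Subsingleton.elim _ _).le⟩
  · obtain ⟨c, hc, h⟩ := (CFC.exists_pos_algebraMap_le_iff (.of_nonneg hT.nonneg)).2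
      fun x hx ↦ hT.spectrum_pos hx
    exact ⟨c, hc, by rwa [← Algebra.algebraMap_eq_smul_one]⟩

lemma exists_pos_forall_smul_one_le {ι : Type*} [Finite ι] {T : ι → E →L[ℂ] E}
    (hT : ∀ i, IsStrictlyPositive (T i)) : ∃ c : ℝ, 0 < c ∧ ∀ i, c • 1 ≤ T i := by
  choose c hc hcT using fun i ↦ (hT i).exists_pos_smul_one_le
  have h : ∀ᶠ r in nhdsWithin (0 : ℝ) (Set.Ioi 0), ∀ i, r ≤ c i :=
    Filter.eventually_all.2 fun i ↦ Filter.mem_of_superset (Ioc_mem_nhdsGT (hc i)) fun r hr ↦ hr.2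
  obtain ⟨r, hr, hr0⟩ := (h.and self_mem_nhdsWithin).exists
  exact ⟨r, hr0, fun i ↦ (smul_le_smul_of_nonneg_right (hr i) zero_le_one).trans (hcT i)⟩

lemma positive_map_mono (hΦ : ∀ B, 0 ≤ B → 0 ≤ Φ B) {S T : E →L[ℂ] E} (h : S ≤ T) :
    Φ S ≤ Φ T := by
  simpa using hΦ _ (sub_nonneg.2 h)

lemma IsStrictlyPositive.positive_map (hΦ1 : Φ 1 = 1) (hΦ : ∀ B, 0 ≤ B → 0 ≤ Φ B)
    {T : E →L[ℂ] E} (hT : IsStrictlyPositive T) : IsStrictlyPositive (Φ T) := by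
  obtain ⟨c, hc, h⟩ := hT.exists_pos_smul_one_le
  exact isStrictlyPositive_of_smul_one_le hc (map_real_smul_one hΦ1 c ▸ positive_map_mono hΦ h)

lemma re_inner_positive_map_inverse_nonneg (hΦ1 : Φ 1 = 1) (hΦ : ∀ B, 0 ≤ B → 0 ≤ Φ B)
    {T : E →L[ℂ] E} (hT : IsStrictlyPositive T) (x y : E) :
    0 ≤ (inner ℂ (Φ T x) x).re + 2 * (inner ℂ x y).re +
      (inner ℂ (Φ (Ring.inverse T) y) y).re := by
  let ψ (u v : E) : (E →L[ℂ] E) →ₗ[ℝ] ℝ :=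
    { toFun := fun S ↦ (inner ℂ (Φ S u) v).re
      map_add' := fun S S' ↦ by simp
      map_smul' := fun r S ↦ by
        rw [LinearMap.map_smul_of_tower]
        simp [inner_smul_left_eq_smul] }
  have hψ1 : ∀ u v, ψ u v 1 = (inner ℂ u v).re := fun u v ↦ by simp [ψ, hΦ1]
  have hψ : ∀ u {S S' : E →L[ℂ] E}, S ≤ S' → ψ u u S ≤ ψ u u S' := fun u S S' h ↦ by
    have := (hΦ _ (sub_nonneg.2 h))
    rw [ContinuousLinearMap.nonneg_iff_isPositive] at this
    have : 0 ≤ ψ u u (S' - S) := this.re_inner_nonneg_left u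
    rwa [map_sub, sub_nonneg] at this
  suffices h : ∀ ε > 0, 0 ≤ (ψ x x T + 2 * (inner ℂ x y).re + ψ y y (Ring.inverse T)) +
      ε * ((inner ℂ x x).re + (inner ℂ y y).re) by
    have hlim : Filter.Tendsto (fun ε : ℝ ↦ (ψ x x T + 2 * (inner ℂ x y).re +
        ψ y y (Ring.inverse T)) + ε * ((inner ℂ x x).re + (inner ℂ y y).re))
        (nhdsWithin 0 (Set.Ioi 0))
        (nhds ((ψ x x T + 2 * (inner ℂ x y).re + ψ y y (Ring.inverse T)) +
          0 * ((inner ℂ x x).re + (inner ℂ y y).re))) :=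
      (Continuous.tendsto (by fun_prop) 0).mono_left nhdsWithin_le_nhds
    rw [zero_mul, add_zero] at hlim
    exact ge_of_tendsto hlim (Filter.eventually_of_mem self_mem_nhdsWithin h)
  intro ε hε
  obtain ⟨m, P, t, hP, hP1, ht, hPT, hPT'⟩ := hT.exists_approx_resolution hε
  have hsum : 0 ≤ ∑ k, (t k * ψ x x (P k) + 2 * ψ x y (P k) + (t k)⁻¹ * ψ y y (P k)) :=
    Finset.sum_nonneg fun k _ ↦ re_inner_quadratic_nonneg (hΦ _ (hP k)) (ht k) x y
  have h1 := hψ x hPT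
  have h2 := hψ y hPT'
  have h3 : ∑ k, ψ x y (P k) = (inner ℂ x y).re := by rw [← map_sum, hP1, hψ1]
  simp only [map_sum, map_add, map_smul, hψ1, smul_eq_mul] at h1 h2
  rw [Finset.sum_add_distrib, Finset.sum_add_distrib, ← Finset.mul_sum, h3] at hsum
  linarith

/-- Choi's inequality for positive unital linear maps. -/
lemma inverse_positive_map_le (hΦ1 : Φ 1 = 1) (hΦ : ∀ B, 0 ≤ B → 0 ≤ Φ B)
    {T : E →L[ℂ] E} (hT : IsStrictlyPositive T) :
    Ring.inverse (Φ T) ≤ Φ (Ring.inverse T) := by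
  have hΦT := hT.positive_map hΦ1 hΦ
  have hsa : IsSelfAdjoint (Φ (Ring.inverse T) - Ring.inverse (Φ T)) :=
    (IsSelfAdjoint.of_nonneg (hΦ _ hT.ringInverse.nonneg)).sub (.of_nonneg hΦT.ringInverse.nonneg)
  rw [ContinuousLinearMap.le_def, ContinuousLinearMap.isPositive_def']
  refine ⟨hsa, fun y ↦ ?_⟩
  have h := re_inner_positive_map_inverse_nonneg hΦ1 hΦ hT (-Ring.inverse (Φ T) y) y
  have hR : Φ T (Ring.inverse (Φ T) y) = y := by
    rw [← mul_apply_eq_comp, Ring.mul_inverse_cancel _ hΦT.isUnit,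
      one_apply_eq_self]
  have hs : (inner ℂ y (Ring.inverse (Φ T) y)).re = (inner ℂ (Ring.inverse (Φ T) y) y).re := by
    rw [← inner_conj_symm, Complex.conj_re]
  rw [map_neg, hR, inner_neg_neg, inner_neg_left, Complex.neg_re, hs] at h
  simp only [ContinuousLinearMap.reApplyInnerSelf, sub_apply, inner_sub_left,
    RCLike.re_to_complex, Complex.sub_re]
  linarith

/-- An ordered mean of operators bounded below by `c` is bounded below by `c`. -/
lemma OrderedMean.smul_one_le (G : OrderedMean E) {n : ℕ} {w : Fin n → ℝ} (hw : IsProbVec w)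
    {A : Fin n → (E →L[ℂ] E)} {c : ℝ} (hc : 0 < c) (hA : ∀ i, c • 1 ≤ A i) :
    c • 1 ≤ G.G n w A := by
  have hc1 : IsStrictlyPositive (c • 1 : E →L[ℂ] E) := isStrictlyPositive_one.smul hc
  have hcP : ∀ _ : Fin n, IsPosDef (c • 1 : E →L[ℂ] E) :=
    fun _ ↦ isPosDef_iff_isStrictlyPositive.2 hc1
  have h := G.harm_le n w (fun _ ↦ c • 1) hw hcP
  rw [← Finset.sum_smul, hw.2, one_smul, Ring.inverse_inverse hc1.isUnit] at h
  exact h.trans (G.mono n w A _ hw (fun i ↦ isPosDef_iff_isStrictlyPositive.2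
    (isStrictlyPositive_of_smul_one_le hc (hA i))) hcP hA)

end Hilbert

theorem pMean_positive_map (G : OrderedMean H)
    (hG : ∀ (n : ℕ) (w : Fin n → ℝ) (A : Fin n → (H →L[ℂ] H))
      (Φ : (H →L[ℂ] H) →ₗ[ℂ] (H →L[ℂ] H)), IsProbVec w → (∀ i, IsPosDef (A i)) →
      Φ 1 = 1 → (∀ B : H →L[ℂ] H, 0 ≤ B → 0 ≤ Φ B) →
      Φ (G.G n w A) ≤ G.G n w (fun i => Φ (A i)))
    {n : ℕ} (w : Fin n → ℝ) (hw : IsProbVec w) (A : Fin n → (H →L[ℂ] H))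
    (hA : ∀ i, IsPosDef (A i)) (Φ : (H →L[ℂ] H) →ₗ[ℂ] (H →L[ℂ] H))
    (hΦ1 : Φ 1 = 1) (hΦpos : ∀ B : H →L[ℂ] H, 0 ≤ B → 0 ≤ Φ B) (μ : ℝ) :
    (0 ≤ μ → Φ (G.pMean μ n w A) ≤ G.pMean μ n w (fun i => Φ (A i))) ∧
    (μ < 0 → G.pMean μ n w (fun i => Ring.inverse (Φ (Ring.inverse (A i)))) ≤
      Φ (G.pMean μ n w A)) := by
  have main : ∀ (ν : ℝ) (B : Fin n → (H →L[ℂ] H)), 0 ≤ ν → (∀ i, IsStrictlyPositive (B i)) →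
      Φ (G.G n w (fun i ↦ B i + ν • 1) - ν • 1) ≤ G.G n w (fun i ↦ Φ (B i) + ν • 1) - ν • 1 := by
    intro ν B hν hB
    have h := hG n w (fun i ↦ B i + ν • 1) Φ hw (fun i ↦ isPosDef_iff_isStrictlyPositive.2
      ((hB i).add_nonneg (smul_nonneg hν zero_le_one))) hΦ1 hΦpos
    simp only [map_add, map_real_smul_one hΦ1] at h
    rw [map_sub, map_real_smul_one hΦ1]
    exact sub_le_sub_right h _
  refine ⟨fun hμ ↦ ?_, fun hμ ↦ ?_⟩
  · simp only [OrderedMean.pMean, if_pos hμ]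
    exact main μ A hμ fun i ↦ isPosDef_iff_isStrictlyPositive.1 (hA i)
  · have hν : 0 ≤ -μ := by linarith
    have hB : ∀ i, IsStrictlyPositive (Ring.inverse (A i)) :=
      fun i ↦ (isPosDef_iff_isStrictlyPositive.1 (hA i)).ringInverse
    simp only [OrderedMean.pMean, if_neg hμ.not_ge]
    have hinv : ∀ i, Ring.inverse (Ring.inverse (Φ (Ring.inverse (A i)))) =
        Φ (Ring.inverse (A i)) :=
      fun i ↦ Ring.inverse_inverse ((hB i).positive_map hΦ1 hΦpos).isUnit
    simp only [hinv]
    have hX : IsStrictlyPositive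
        (G.G n w (fun i ↦ Ring.inverse (A i) + (-μ) • 1) - (-μ) • 1) := by
      obtain ⟨c, hc, h⟩ := exists_pos_forall_smul_one_le hB
      refine isStrictlyPositive_of_smul_one_le hc (le_sub_iff_add_le.2 ?_)
      rw [← add_smul]
      refine G.smul_one_le hw (by linarith) fun i ↦ ?_
      rw [add_smul]
      exact add_le_add_left (h i) _
    exact (CStarAlgebra.ringInverse_le_ringInverse (main (-μ) _ hν hB)
      (hX.positive_map hΦ1 hΦpos)).trans (inverse_positive_map_le hΦ1 hΦpos hX)
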